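/- arXiv:2109.03236 — 2 statements merged into one kernel-verified Lean document; each statement's English description precedes it below -/
import Mathlib

section
/- Let R be an RNA secondary structure of length n (a partial matching M of base pairs on positions 1..n) and let G be its dual graph. If a block (maximal non-separable subgraph) of G contains a vertex of degree at least 3 (where the degree of a vertex u is the number of edges of the block incident at u), then the region of the primary sequence spanned by the stems corresponding to the vertices of that block contains a pseudoknot, i.e., there exist two base pairs (i,j) and (l,m) of M within that region with i < l < j < m. -/
/-! ## Multigraphs, subgraphs, blocks, degrees, connectivity -/

/-- A multigraph on vertex type `V` with edge type `E`: each edge is assigned an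
unordered pair of endpoints. -/
structure Multigraph (V E : Type) where
  ends : E → Sym2 V

namespace Multigraph

variable {V E : Type}

/-- The degree of a vertex `u`: the number of edges incident at `u`. -/
noncomputable def degree (G : Multigraph V E) (u : V) : ℕ :=
  Set.ncard {e | u ∈ G.ends e}

/-- A subgraph of a multigraph: a set of vertices together with a set of edges
all of whose endpoints lie in the vertex set. -/
structure Subgraph (G : Multigraph V E) where
  verts : Set V
  edges : Set E
  ends_mem : ∀ e ∈ edges, ∀ v, v ∈ G.ends e → v ∈ verts

namespace Subgraph

variable {G : Multigraph V E}

/-- The degree of a vertex `u` in a subgraph `H`: the number of edges of `H`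
incident at `u`. -/
noncomputable def degree (H : G.Subgraph) (u : V) : ℕ :=
  Set.ncard {e ∈ H.edges | u ∈ G.ends e}

/-- One step along an edge of the subgraph `H`, avoiding the deleted edges `F`
and the deleted vertices `W`. -/
def Adj (H : G.Subgraph) (F : Set E) (W : Set V) (a b : V) : Prop :=
  a ∈ H.verts ∧ b ∈ H.verts ∧ a ∉ W ∧ b ∉ W ∧
    ∃ e ∈ H.edges, e ∉ F ∧ G.ends e = s(a, b)

/-- The subgraph `H` is connected after deleting the edges in `F` and the
vertices in `W`: any two remaining vertices are joined by a walk. -/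
def ConnectedAvoiding (H : G.Subgraph) (F : Set E) (W : Set V) : Prop :=
  ∀ u ∈ H.verts \ W, ∀ v ∈ H.verts \ W, Relation.ReflTransGen (H.Adj F W) u v

/-- The subgraph `H` is connected (and nonempty). -/
def Connected (H : G.Subgraph) : Prop :=
  H.verts.Nonempty ∧ H.ConnectedAvoiding ∅ ∅

/-- `w` is an articulation point of `H`: deleting `w` disconnects `H`. -/
def IsArticulation (H : G.Subgraph) (w : V) : Prop :=
  w ∈ H.verts ∧ ¬ H.ConnectedAvoiding ∅ {w}

/-- A block of `G`: a maximal connected subgraph without articulation points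
(maximal non-separable component). -/
def IsBlock (H : G.Subgraph) : Prop :=
  H.Connected ∧ (∀ w, ¬ H.IsArticulation w) ∧
    ∀ H' : G.Subgraph, H'.Connected → (∀ w, ¬ H'.IsArticulation w) →
      H.verts ⊆ H'.verts → H.edges ⊆ H'.edges →
      H.verts = H'.verts ∧ H.edges = H'.edges

/-- The subgraph `H` has edge-connectivity exactly `2`: it is connected, it
remains connected after deleting any single edge, but some two edges
disconnect it. -/
def EdgeConnTwo (H : G.Subgraph) : Prop :=
  H.Connected ∧ (∀ e : E, H.ConnectedAvoiding {e} ∅) ∧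
    ∃ e₁ ∈ H.edges, ∃ e₂ ∈ H.edges, e₁ ≠ e₂ ∧ ¬ H.ConnectedAvoiding {e₁, e₂} ∅

/-- `H` consists of a single edge together with its endpoints. -/
def IsSingleEdge (H : G.Subgraph) : Prop :=
  ∃ e, H.edges = {e} ∧ H.verts = {v | v ∈ G.ends e}

/-- `H` is a cycle: a connected graph in which every vertex has degree
exactly `2`. -/
def IsCycle (H : G.Subgraph) : Prop :=
  H.Connected ∧ ∀ v ∈ H.verts, H.degree v = 2

end Subgraph

end Multigraph

/-! ## RNA secondary structures, stems, segments and the dual (di)graph -/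

/-- An RNA secondary structure of length `n`: a set `pairs` of base pairs
`(i, j)` with `1 ≤ i < j ≤ n` in which every position occurs in at most one
base pair (a partial matching). -/
structure RNA (n : ℕ) where
  pairs : Finset (ℕ × ℕ)
  one_le : ∀ p ∈ pairs, 1 ≤ p.1
  fst_lt_snd : ∀ p ∈ pairs, p.1 < p.2
  le_length : ∀ p ∈ pairs, p.2 ≤ n
  matching : ∀ p ∈ pairs, ∀ q ∈ pairs, p ≠ q →
    p.1 ≠ q.1 ∧ p.1 ≠ q.2 ∧ p.2 ≠ q.1 ∧ p.2 ≠ q.2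

namespace RNA

variable {n : ℕ}

/-- Position `p` is paired (belongs to some base pair). -/
def Paired (R : RNA n) (p : ℕ) : Prop :=
  ∃ q, (p, q) ∈ R.pairs ∨ (q, p) ∈ R.pairs

/-- A stem of `R`: a maximal tuple of consecutively nested base pairs
`(i, j), (i+1, j-1), …, (i+r, j-r)` of `R`. -/
structure Stem (R : RNA n) where
  i : ℕ
  j : ℕ
  r : ℕ
  nested : ∀ k ≤ r, (i + k, j - k) ∈ R.pairs
  sep : i + r < j - r
  max_out : (i - 1, j + 1) ∉ R.pairs
  max_in : (i + r + 1, j - (r + 1)) ∉ R.pairs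

/-- Position `p` is occupied by the stem `S`. -/
def Stem.MemPos {R : RNA n} (S : Stem R) (p : ℕ) : Prop :=
  ∃ k ≤ S.r, p = S.i + k ∨ p = S.j - k

/-- `(a, b)` is one of the base pairs of the stem `S`. -/
def Stem.MemPair {R : RNA n} (S : Stem R) (a b : ℕ) : Prop :=
  ∃ k ≤ S.r, a = S.i + k ∧ b = S.j - k

/-- `S` is a super-stem of `T` (written `S > T` in the paper): the region
occupied by `T` is strictly contained inside the paired region of `S`. -/
def SuperStem {R : RNA n} (S T : Stem R) : Prop :=
  S.i + S.r < T.i ∧ T.j < S.j - S.r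

/-- A single-stranded segment running, 5' to 3', from the paired position `p`
to the next paired position `q`: all strictly intermediate positions are
unpaired. -/
def IsSegment (R : RNA n) (p q : ℕ) : Prop :=
  p < q ∧ R.Paired p ∧ R.Paired q ∧ ∀ t, p < t → t < q → ¬ R.Paired t

/-- An edge of the dual (di)graph of `R`: a single-stranded segment running
from an occurrence (position `p`) of stem `src` to an occurrence (position
`q`) of stem `tgt`, with self-loops (hairpins, `src = tgt`) deleted.  Read as
a directed edge it is directed from `src` to `tgt` (5' to 3'). -/
structure DualEdge (R : RNA n) where
  p : ℕ
  q : ℕ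
  src : Stem R
  tgt : Stem R
  seg : R.IsSegment p q
  mem_src : src.MemPos p
  mem_tgt : tgt.MemPos q
  ne : src ≠ tgt

/-- The dual graph of `R`: vertices are the stems of `R`, and each
single-stranded segment between occurrences of two distinct stems contributes
one edge between them. -/
def dualGraph (R : RNA n) : Multigraph (Stem R) (DualEdge R) :=
  ⟨fun e => s(e.src, e.tgt)⟩

/-- The weight of a directed edge of the dual digraph: the order (1st, 2nd, …)
in which the corresponding segment is reached along the primary sequence,
i.e. the number of segments starting no later than it. -/
noncomputable def DualEdge.weight {R : RNA n} (e : DualEdge R) : ℕ :=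
  Set.ncard {p' | ∃ q', R.IsSegment p' q' ∧ p' ≤ e.p}

end RNA

namespace RNA

variable {n : ℕ}

theorem Stem.unique_aux {R : RNA n} (S T : Stem R) {k l : ℕ} (hk : k ≤ S.r) (hl : l ≤ T.r)
    (h1 : S.i + k = T.i + l) (h2 : S.j - k = T.j - l) : ¬ k < l := by
  intro hkl
  have hs := S.sep
  have ht := T.sep
  have h := T.nested (l - k - 1) (by omega)
  apply S.max_out
  have e1 : S.i - 1 = T.i + (l - k - 1) := by omega
  have e2 : S.j + 1 = T.j - (l - k - 1) := by omega
  rw [e1, e2]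
  exact h

theorem Stem.unique_r {R : RNA n} (S T : Stem R) 
    (h1 : S.i = T.i) (h2 : S.j = T.j) : ¬ S.r < T.r := by
  intro h
  apply S.max_in
  rw [h1, h2, add_assoc]
  exact T.nested (S.r + 1) h

theorem Stem.unique {R : RNA n} (S T : Stem R) (p : ℕ) (hS : S.MemPos p) (hT : T.MemPos p) :
    S = T := by
  obtain ⟨k, hk, hpk⟩ := hS
  obtain ⟨l, hl, hpl⟩ := hT
  have a1 := S.nested k hk
  have a2 := T.nested l hl
  have b1 := R.fst_lt_snd _ a1
  have b2 := R.fst_lt_snd _ a2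
  have m := R.matching _ a1 _ a2
  simp only at b1 b2 m
  have key : S.i + k = T.i + l ∧ S.j - k = T.j - l := by
    by_cases h : (S.i + k, S.j - k) = (T.i + l, T.j - l)
    · simpa using h
    · have := m h
      omega
  have hs := S.sep
  have ht := T.sep
  have c1 := Stem.unique_aux S T hk hl key.1 key.2
  have c2 := Stem.unique_aux T S hl hk key.1.symm key.2.symm
  have d1 : S.i = T.i := by omega
  have d2 : S.j = T.j := by omega
  have e1 := Stem.unique_r S T d1 d2
  have e2 := Stem.unique_r T S d1.symm d2.symm
  have d3 : S.r = T.r := by omega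
  cases S
  cases T
  simp only at d1 d2 d3
  subst d1 d2 d3
  rfl

theorem Stem.paired {R : RNA n} (S : Stem R) {p : ℕ} (hS : S.MemPos p) : R.Paired p := by
  obtain ⟨k, hk, h | h⟩ := hS
  · exact ⟨S.j - k, Or.inl (h ▸ S.nested k hk)⟩
  · exact ⟨S.i + k, Or.inr (h ▸ S.nested k hk)⟩

theorem Stem.memL {R : RNA n} (S : Stem R) {p : ℕ} (h1 : S.i ≤ p) (h2 : p ≤ S.i + S.r) :
    S.MemPos p := ⟨p - S.i, by omega, Or.inl (by omega)⟩

theorem Stem.memR {R : RNA n} (S : Stem R) {p : ℕ} (h1 : S.j - S.r ≤ p) (h2 : p ≤ S.j) :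
    S.MemPos p := ⟨S.j - p, by omega, Or.inr (by omega)⟩

theorem Stem.mem_cases {R : RNA n} (S : Stem R) {p : ℕ} (h : S.MemPos p) :
    (S.i ≤ p ∧ p ≤ S.i + S.r) ∨ (S.j - S.r ≤ p ∧ p ≤ S.j) := by
  obtain ⟨k, hk, h⟩ := h
  omega

theorem DualEdge.ext_p {R : RNA n} (e f : DualEdge R) (h : e.p = f.p) : e = f := by
  have hq : e.q = f.q := by
    obtain ⟨a1, a2, a3, a4⟩ := e.seg
    obtain ⟨b1, b2, b3, b4⟩ := f.seg
    rcases lt_trichotomy e.q f.q with hh | hh | hh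
    · exact absurd a3 (b4 _ (by omega) hh)
    · exact hh
    · exact absurd b3 (a4 _ (by omega) hh)
  have hs := Stem.unique e.src f.src e.p e.mem_src (h ▸ f.mem_src)
  have ht := Stem.unique e.tgt f.tgt e.q e.mem_tgt (hq ▸ f.mem_tgt)
  cases e
  cases f
  simp only at h hq hs ht
  subst h hq hs ht
  rfl

theorem DualEdge.ext_q {R : RNA n} (e f : DualEdge R) (h : e.q = f.q) : e = f := by
  apply DualEdge.ext_p
  obtain ⟨a1, a2, a3, a4⟩ := e.seg
  obtain ⟨b1, b2, b3, b4⟩ := f.seg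
  rcases lt_trichotomy e.p f.p with hh | hh | hh
  · exact absurd b2 (a4 _ hh (by omega))
  · exact hh
  · exact absurd a2 (b4 _ hh (by omega))

theorem DualEdge.src_cases {R : RNA n} (e : DualEdge R) :
    e.p = e.src.i + e.src.r ∨ e.p = e.src.j := by
  by_contra hcon
  obtain ⟨a1, a2, a3, a4⟩ := e.seg
  have hm : e.src.MemPos (e.p + 1) := by
    rcases e.src.mem_cases e.mem_src with h | h
    · exact e.src.memL (by omega) (by omega)
    · exact e.src.memR (by omega) (by omega)
  have hq : e.q = e.p + 1 := by
    by_contra hne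
    exact a4 (e.p + 1) (by omega) (by omega) (e.src.paired hm)
  exact e.ne (Stem.unique _ _ _ hm (hq ▸ e.mem_tgt))

theorem DualEdge.tgt_cases {R : RNA n} (e : DualEdge R) :
    e.q = e.tgt.i ∨ e.q = e.tgt.j - e.tgt.r := by
  by_contra hcon
  obtain ⟨a1, a2, a3, a4⟩ := e.seg
  have hm : e.tgt.MemPos (e.q - 1) := by
    rcases e.tgt.mem_cases e.mem_tgt with h | h
    · exact e.tgt.memL (by omega) (by omega)
    · exact e.tgt.memR (by omega) (by omega)
  have hp : e.p = e.q - 1 := by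
    by_contra hne
    exact a4 (e.q - 1) (by omega) (by omega) (e.tgt.paired hm)
  exact e.ne (Stem.unique _ _ _ (hp ▸ e.mem_src) hm)

/-- A set of edges with at most one edge leaving `u` at `x` and one entering at `y`. -/
theorem ncard_le_two {R : RNA n} (A : Set (DualEdge R)) (x y : ℕ)
    (h : ∀ e ∈ A, e.p = x ∨ e.q = y) : A.ncard ≤ 2 := by
  classical
  have hinj : Set.InjOn (fun e : DualEdge R => decide (e.p = x)) A := by
    intro e he f hf hef
    simp only [decide_eq_decide] at hef
    by_cases hx : e.p = x
    · exact DualEdge.ext_p _ _ (hx.trans (hef.1 hx).symm)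
    · have hx' : f.p ≠ x := fun h => hx (hef.2 h)
      exact DualEdge.ext_q _ _ (((h e he).resolve_left hx).trans ((h f hf).resolve_left hx').symm)
  calc A.ncard = ((fun e : DualEdge R => decide (e.p = x)) '' A).ncard :=
        (Set.ncard_image_of_injOn hinj).symm
    _ ≤ (Set.univ : Set Bool).ncard := Set.ncard_le_ncard (Set.subset_univ _)
    _ = 2 := by simp [Set.ncard_univ]

/-- No crossing: a stem different from `u` with one position strictly inside `u` lies inside. -/
theorem Stem.all_inside {R : RNA n} (u S : Stem R) (hne : S ≠ u)
    (h1 : ¬ (u.i + u.r < S.i ∧ S.i < u.j - u.r ∧ u.j - u.r < S.j))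
    (h2 : ¬ (S.i < u.i + u.r ∧ u.i + u.r < S.j ∧ S.j < u.j - u.r))
    (p q : ℕ) (hp : S.MemPos p) (hq : S.MemPos q) (hin : u.i + u.r < p ∧ p < u.j - u.r) :
    u.i + u.r < q ∧ q < u.j - u.r := by
  have hus := u.sep
  have hSs := S.sep
  have nx : ¬ S.MemPos (u.i + u.r) := fun h =>
    hne (Stem.unique _ _ _ h (u.memL (by omega) (by omega)))
  have ny : ¬ S.MemPos (u.j - u.r) := fun h =>
    hne (Stem.unique _ _ _ h (u.memR (by omega) (by omega)))
  have x1 : ¬ (S.i ≤ u.i + u.r ∧ u.i + u.r ≤ S.i + S.r) := fun h => nx (S.memL h.1 h.2)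
  have x2 : ¬ (S.j - S.r ≤ u.i + u.r ∧ u.i + u.r ≤ S.j) := fun h => nx (S.memR h.1 h.2)
  have y1 : ¬ (S.i ≤ u.j - u.r ∧ u.j - u.r ≤ S.i + S.r) := fun h => ny (S.memL h.1 h.2)
  have y2 : ¬ (S.j - S.r ≤ u.j - u.r ∧ u.j - u.r ≤ S.j) := fun h => ny (S.memR h.1 h.2)
  have hp' := S.mem_cases hp
  have hq' := S.mem_cases hq
  omega

theorem DualEdge.step {R : RNA n} (u : Stem R) (e : DualEdge R) (h1 : e.src ≠ u)
    (h2 : e.tgt ≠ u) :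
    (u.i + u.r < e.p ∧ e.p < u.j - u.r) ↔ (u.i + u.r < e.q ∧ e.q < u.j - u.r) := by
  have hus := u.sep
  obtain ⟨a1, a2, a3, a4⟩ := e.seg
  have mx : u.MemPos (u.i + u.r) := u.memL (by omega) (by omega)
  have my : u.MemPos (u.j - u.r) := u.memR (by omega) (by omega)
  have c1 : e.p ≠ u.i + u.r := fun h => h1 (Stem.unique _ _ _ (h ▸ e.mem_src) mx)
  have c2 : e.p ≠ u.j - u.r := fun h => h1 (Stem.unique _ _ _ (h ▸ e.mem_src) my)
  have c3 : e.q ≠ u.i + u.r := fun h => h2 (Stem.unique _ _ _ (h ▸ e.mem_tgt) mx)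
  have c4 : e.q ≠ u.j - u.r := fun h => h2 (Stem.unique _ _ _ (h ▸ e.mem_tgt) my)
  have d1 : ¬ (e.p < u.i + u.r ∧ u.i + u.r < e.q) := fun h => a4 _ h.1 h.2 (u.paired mx)
  have d2 : ¬ (e.p < u.j - u.r ∧ u.j - u.r < e.q) := fun h => a4 _ h.1 h.2 (u.paired my)
  omega

end RNA

/-- If a block of the dual graph of an RNA secondary structure
contains a vertex of degree at least 3 (degree counted within the block), then
the region of the primary sequence spanned by the stems of that block contains
a pseudoknot: two base pairs `(i, j)` and `(l, m)` with `i < l < j < m`. -/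
theorem block_with_degree_ge_three_is_pseudoknot {n : ℕ} (R : RNA n)
    (B : Multigraph.Subgraph R.dualGraph) (hB : B.IsBlock)
    (hdeg : ∃ u ∈ B.verts, 3 ≤ B.degree u) :
    ∃ i j l m : ℕ, (i, j) ∈ R.pairs ∧ (l, m) ∈ R.pairs ∧
      i < l ∧ l < j ∧ j < m ∧
      ∀ p ∈ ({i, j, l, m} : Set ℕ), ∃ S ∈ B.verts, ∃ T ∈ B.verts, ∃ a b : ℕ,
        S.MemPos a ∧ T.MemPos b ∧ a ≤ p ∧ p ≤ b := by
  classical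
  obtain ⟨u, hu, hd⟩ := hdeg
  by_contra hcon
  have hus := u.sep
  have mx : u.MemPos (u.i + u.r) := u.memL (by omega) (by omega)
  have my : u.MemPos (u.j - u.r) := u.memR (by omega) (by omega)
  have pu := u.nested u.r le_rfl
  -- stems of the block do not cross `u`
  have inside : ∀ S ∈ B.verts, S ≠ u → ∀ p q, S.MemPos p → S.MemPos q →
      (u.i + u.r < p ∧ p < u.j - u.r) → (u.i + u.r < q ∧ q < u.j - u.r) := by
    intro S hS hne p q hp hq hin
    have pS : (S.i, S.j) ∈ R.pairs := by simpa using S.nested 0 (Nat.zero_le _)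
    have hSs := S.sep
    have mi : S.MemPos S.i := S.memL (by omega) (by omega)
    have mj : S.MemPos S.j := S.memR (by omega) (by omega)
    refine RNA.Stem.all_inside u S hne ?_ ?_ p q hp hq hin
    · rintro ⟨c1, c2, c3⟩
      apply hcon
      refine ⟨_, _, _, _, pu, pS, c1, c2, c3, ?_⟩
      rintro t (rfl | rfl | rfl | rfl)
      · exact ⟨u, hu, u, hu, _, _, mx, mx, le_rfl, le_rfl⟩
      · exact ⟨u, hu, u, hu, _, _, my, my, le_rfl, le_rfl⟩
      · exact ⟨S, hS, S, hS, _, _, mi, mi, le_rfl, le_rfl⟩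
      · exact ⟨S, hS, S, hS, _, _, mj, mj, le_rfl, le_rfl⟩
    · rintro ⟨c1, c2, c3⟩
      apply hcon
      refine ⟨_, _, _, _, pS, pu, c1, c2, c3, ?_⟩
      rintro t (rfl | rfl | rfl | rfl)
      · exact ⟨S, hS, S, hS, _, _, mi, mi, le_rfl, le_rfl⟩
      · exact ⟨S, hS, S, hS, _, _, mj, mj, le_rfl, le_rfl⟩
      · exact ⟨u, hu, u, hu, _, _, mx, mx, le_rfl, le_rfl⟩
      · exact ⟨u, hu, u, hu, _, _, my, my, le_rfl, le_rfl⟩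
  -- edges incident with `u`
  have hinc : ∀ e : RNA.DualEdge R, u ∈ R.dualGraph.ends e → e.src = u ∨ e.tgt = u := by
    intro e he
    have : u ∈ s(e.src, e.tgt) := he
    rcases Sym2.mem_iff.1 this with h | h
    · exact Or.inl h.symm
    · exact Or.inr h.symm
  have hsv : ∀ e ∈ B.edges, e.src ∈ B.verts := fun e he =>
    B.ends_mem e he _ (Sym2.mem_mk_left e.src e.tgt)
  have htv : ∀ e ∈ B.edges, e.tgt ∈ B.verts := fun e he =>
    B.ends_mem e he _ (Sym2.mem_mk_right e.src e.tgt)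
  have hin : ∃ T ∈ B.verts, T ≠ u ∧ ∃ p, T.MemPos p ∧ u.i + u.r < p ∧ p < u.j - u.r := by
    by_contra hno
    have : B.degree u ≤ 2 := by
      refine RNA.ncard_le_two _ u.j u.i ?_
      rintro e ⟨heB, heu⟩
      by_contra hc
      obtain ⟨a1, a2, a3, a4⟩ := e.seg
      rcases hinc e heu with h | h
      · have hp : e.p = u.i + u.r := by
          have := e.src_cases
          rw [h] at this
          omega
        have hne : e.tgt ≠ u := fun h' => e.ne (h.trans h'.symm)
        apply hno
        refine ⟨e.tgt, htv e heB, hne, e.q, e.mem_tgt, by omega, ?_⟩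
        have c1 : e.q ≠ u.j - u.r := fun h' =>
          hne (RNA.Stem.unique _ _ _ (h' ▸ e.mem_tgt) my)
        have c2 : ¬ (e.p < u.j - u.r ∧ u.j - u.r < e.q) := fun h' =>
          a4 _ h'.1 h'.2 (u.paired my)
        omega
      · have hp : e.q = u.j - u.r := by
          have := e.tgt_cases
          rw [h] at this
          omega
        have hne : e.src ≠ u := fun h' => e.ne (h'.trans h.symm)
        apply hno
        refine ⟨e.src, hsv e heB, hne, e.p, e.mem_src, ?_, by omega⟩
        have c1 : e.p ≠ u.i + u.r := fun h' =>
          hne (RNA.Stem.unique _ _ _ (h' ▸ e.mem_src) mx)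
        have c2 : ¬ (e.p < u.i + u.r ∧ u.i + u.r < e.q) := fun h' =>
          a4 _ h'.1 h'.2 (u.paired mx)
        omega
    omega
  have hout : ∃ T ∈ B.verts, T ≠ u ∧ ∃ p, T.MemPos p ∧ ¬ (u.i + u.r < p ∧ p < u.j - u.r) := by
    by_contra hno
    have : B.degree u ≤ 2 := by
      refine RNA.ncard_le_two _ (u.i + u.r) (u.j - u.r) ?_
      rintro e ⟨heB, heu⟩
      by_contra hc
      obtain ⟨a1, a2, a3, a4⟩ := e.seg
      rcases hinc e heu with h | h
      · have hp : e.p = u.j := by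
          have := e.src_cases
          rw [h] at this
          omega
        have hne : e.tgt ≠ u := fun h' => e.ne (h.trans h'.symm)
        apply hno
        exact ⟨e.tgt, htv e heB, hne, e.q, e.mem_tgt, by omega⟩
      · have hp : e.q = u.i := by
          have := e.tgt_cases
          rw [h] at this
          omega
        have hne : e.src ≠ u := fun h' => e.ne (h'.trans h.symm)
        apply hno
        exact ⟨e.src, hsv e heB, hne, e.p, e.mem_src, by omega⟩
    omega
  obtain ⟨T, hT, hTu, p, hp, hpin⟩ := hin
  obtain ⟨T', hT', hTu', p', hp', hpout⟩ := hout
  have hconn : B.ConnectedAvoiding ∅ {u} := by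
    by_contra h
    exact hB.2.1 u ⟨hu, h⟩
  have hpath := hconn T ⟨hT, hTu⟩ T' ⟨hT', hTu'⟩
  have hinv : ∀ q, T'.MemPos q → u.i + u.r < q ∧ q < u.j - u.r := by
    clear hpout hp' hTu' hT'
    induction hpath with
    | refl => exact fun q hq => inside T hT hTu p q hp hq hpin
    | @tail S S' _ hadj ih =>
      obtain ⟨hS, hS', hSu, hSu', e, heB, _, hends⟩ := hadj
      intro q hq
      have he : s(e.src, e.tgt) = s(S, S') := hends
      rcases Sym2.eq_iff.1 he with ⟨h1, h2⟩ | ⟨h1, h2⟩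
      · have st := RNA.DualEdge.step u e (by rw [h1]; exact hSu) (by rw [h2]; exact hSu')
        exact inside S' hS' hSu' e.q q (h2 ▸ e.mem_tgt) hq (st.1 (ih _ (h1 ▸ e.mem_src)))
      · have st := RNA.DualEdge.step u e (by rw [h1]; exact hSu') (by rw [h2]; exact hSu)
        exact inside S' hS' hSu' e.p q (h1 ▸ e.mem_src) hq (st.2 (ih _ (h2 ▸ e.mem_tgt)))
  exact hpout (hinv p' hp')
end

section
/- The converse of the super-stem detection criterion fails: there exists an RNA secondary structure with stems S_i and S_j such that S_i is a super-stem of S_j (the region occupied by S_j is strictly contained in the paired region of S_i), yet in the weighted dual digraph of the structure there do not exist exactly two anti-parallel directed edges between the vertices S_i and S_j with weight difference at least 2 (in particular, this occurs when a third stem intercepts the primary sequence between S_i and S_j). -/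
/-- Three nested one-pair stems, `(1,12) ⊃ (3,10) ⊃ (5,8)`. -/
def exRNA : RNA 12 where
  pairs := {(1, 12), (3, 10), (5, 8)}
  one_le := by decide
  fst_lt_snd := by decide
  le_length := by decide
  matching := by decide

def exOuter : RNA.Stem exRNA where
  i := 1
  j := 12
  r := 0
  nested := by
    intro k hk
    obtain rfl : k = 0 := by omega
    decide
  sep := by decide
  max_out := by decide
  max_in := by decide

def exInner : RNA.Stem exRNA where
  i := 5
  j := 8
  r := 0
  nested := by
    intro k hk
    obtain rfl : k = 0 := by omega
    decide
  sep := by decide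
  max_out := by decide
  max_in := by decide

/-- The converse of the super-stem detection criterion fails:
there is an RNA secondary structure with stems `Si` and `Sj` such that `Si`
is a super-stem of `Sj`, yet in the weighted dual digraph there do not exist
exactly two anti-parallel directed edges between `Si` and `Sj` whose weights
differ by at least 2. -/
theorem superStem_converse_fails :
    ∃ (n : ℕ) (R : RNA n) (Si Sj : RNA.Stem R),
      RNA.SuperStem Si Sj ∧
      ¬ ∃ e₁ e₂ : RNA.DualEdge R,
          (e₁.src = Si ∧ e₁.tgt = Sj) ∧ (e₂.src = Sj ∧ e₂.tgt = Si) ∧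
          (∀ e : RNA.DualEdge R,
            (e.src = Si ∧ e.tgt = Sj) ∨ (e.src = Sj ∧ e.tgt = Si) →
              e = e₁ ∨ e = e₂) ∧
          e₁.weight + 2 ≤ e₂.weight := by
  refine ⟨12, exRNA, exOuter, exInner, ⟨by decide, by decide⟩, ?_⟩
  rintro ⟨e₁, _, ⟨hs, ht⟩, _⟩
  obtain ⟨hlt, _, _, hno⟩ := e₁.seg
  obtain ⟨k, hk, hp⟩ := e₁.mem_src
  obtain ⟨l, hl, hq⟩ := e₁.mem_tgt
  rw [hs] at hk hp
  rw [ht] at hl hq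
  simp only [exOuter] at hk hp
  simp only [exInner] at hl hq
  exact hno 3 (by omega) (by omega) ⟨10, Or.inl (by decide)⟩
end
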